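/- arXiv:2604.23708 — 6 statements merged into one kernel-verified Lean document; each statement's English description precedes it below -/
import Mathlib

section
/- For every t > 0, the function P_t is a probability density on (0,1): the integral ∫₀¹ P_t(p) dp converges and equals 1. -/
open MeasureTheory Real

/-- Modified Bessel function of the first kind, integral representation. -/
noncomputable def besselI (n : ℕ) (x : ℝ) : ℝ :=
  (1 / (2 * Real.pi)) * ∫ θ in (0:ℝ)..(2 * Real.pi), Real.exp (x * Real.cos θ) * Real.cos (n * θ)

/-- The limiting eigenvector-norm density `P_t`. -/
noncomputable def Pdens (t p : ℝ) : ℝ :=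
  (t / (p * (1 - p))) * Real.exp (-t * (p / (1 - p) + (1 - p) / p)) *
    (besselI 1 (2 * t) + (1 / 2) * (p / (1 - p) + (1 - p) / p) * besselI 0 (2 * t))

/-- The fundamental strip on which the complex hyperbolic sine is injective. -/
def sinhStrip : Set ℂ := {w | w.im ∈ Set.Ioo (-(π / 2)) (π / 2)}

lemma measurableSet_sinhStrip : MeasurableSet sinhStrip :=
  Complex.measurable_im measurableSet_Ioo

lemma exp_re_pos_of_mem_sinhStrip {w : ℂ} (hw : w ∈ sinhStrip) : 0 < (Complex.exp w).re := by
  rw [Complex.exp_re]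
  exact mul_pos (Real.exp_pos _) (Real.cos_pos_of_mem_Ioo hw)

lemma injOn_sinh_sinhStrip : Set.InjOn Complex.sinh sinhStrip := by
  intro w hw z hz h
  have hwre := exp_re_pos_of_mem_sinhStrip hw
  have hzre := exp_re_pos_of_mem_sinhStrip hz
  have hexp : Complex.exp w = Complex.exp z := by
    have hw0 := Complex.exp_ne_zero w
    have hz0 := Complex.exp_ne_zero z
    rw [Complex.sinh, Complex.sinh, Complex.exp_neg, Complex.exp_neg] at h
    have hfac : (Complex.exp w - Complex.exp z) * (1 + Complex.exp w * Complex.exp z) = 0 := by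
      field_simp at h
      linear_combination h
    rcases mul_eq_zero.mp hfac with h1 | h1
    · exact sub_eq_zero.mp h1
    · exfalso
      have h2 : Complex.exp w = -(Complex.exp z)⁻¹ := by
        field_simp
        linear_combination h1
      have h3 : (Complex.exp w).re = -((Complex.exp z).re / Complex.normSq (Complex.exp z)) := by
        rw [h2, Complex.neg_re, Complex.inv_re]
      have h4 : 0 < (Complex.exp z).re / Complex.normSq (Complex.exp z) :=
        div_pos hzre (Complex.normSq_pos.mpr hz0)
      linarith
  have hpi := Real.pi_pos
  rw [← Complex.log_exp (x := w) (by linarith [hw.1]) (by linarith [hw.2]), hexp,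
    Complex.log_exp (by linarith [hz.1]) (by linarith [hz.2])]

lemma mem_image_sinh_of_re_ne_zero {z : ℂ} (hz : z.re ≠ 0) : z ∈ Complex.sinh '' sinhStrip := by
  have key : ∀ y : ℂ, 0 < y.re → y ^ 2 - 2 * z * y - 1 = 0 → z ∈ Complex.sinh '' sinhStrip := by
    intro y hy h
    have hy0 : y ≠ 0 := fun h0 => by simp [h0] at hy
    refine ⟨Complex.log y, ?_, ?_⟩
    · rw [sinhStrip, Set.mem_ofPred_eq, Complex.log_im]
      exact abs_lt.mp (Complex.abs_arg_lt_pi_div_two_iff.mpr (Or.inl hy))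
    · rw [Complex.sinh, Complex.exp_neg, Complex.exp_log hy0]
      field_simp
      linear_combination h
  obtain ⟨s, hs⟩ := IsAlgClosed.exists_pow_nat_eq (z ^ 2 + 1) two_pos
  have hroot : (z + s) ^ 2 - 2 * z * (z + s) - 1 = 0 := by linear_combination hs
  have hroot' : (z - s) ^ 2 - 2 * z * (z - s) - 1 = 0 := by linear_combination hs
  have hprod : (z + s) * (z - s) = -1 := by linear_combination -hs
  have hne : z + s ≠ 0 := fun h => by simp [h] at hprod
  have hinv : z - s = -(z + s)⁻¹ := by
    field_simp
    linear_combination hprod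
  have hre : (z - s).re = -((z + s).re / Complex.normSq (z + s)) := by
    rw [hinv, Complex.neg_re, Complex.inv_re]
  have hpos := Complex.normSq_pos.mpr hne
  rcases lt_trichotomy (z + s).re 0 with h | h | h
  · exact key _ (by rw [hre]; linarith [div_neg_of_neg_of_pos h hpos]) hroot'
  · rw [h, zero_div, neg_zero, Complex.sub_re] at hre
    rw [Complex.add_re] at h
    exact absurd (by linarith) hz
  · exact key _ h hroot

lemma image_sinh_sinhStrip_ae_eq_univ :
    (Complex.sinh '' sinhStrip : Set ℂ) =ᵐ[volume] (Set.univ : Set ℂ) := by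
  rw [ae_eq_univ]
  refine measure_mono_null (t := (LinearMap.ker Complex.reLm : Set ℂ)) ?_ ?_
  · intro z hz
    by_contra h
    exact hz (mem_image_sinh_of_re_ne_zero (by simpa using h))
  · refine Measure.addHaar_submodule _ _ fun h => ?_
    have : (1 : ℂ) ∈ LinearMap.ker Complex.reLm := by rw [h]; trivial
    simp at this

/-- The Gaussian on `ℂ` pulled back along `sinh`. -/
lemma gaussian_comp_sinh {b : ℝ} (hb : 0 < b) :
    IntegrableOn (fun w : ℂ => Complex.normSq (Complex.cosh w) *
        Real.exp (-b * ‖Complex.sinh w‖ ^ 2)) sinhStrip ∧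
      ∫ w in sinhStrip, Complex.normSq (Complex.cosh w) *
        Real.exp (-b * ‖Complex.sinh w‖ ^ 2) = π / b := by
  have hgauss : ∫ z : ℂ, Real.exp (-b * ‖z‖ ^ 2) = π / b := by
    rw [GaussianFourier.integral_rexp_neg_mul_sq_norm hb]
    simp
  have hint : Integrable (fun z : ℂ => Real.exp (-b * ‖z‖ ^ 2)) :=
    Integrable.of_integral_ne_zero (by rw [hgauss]; positivity)
  have hderiv : ∀ w ∈ sinhStrip, HasFDerivWithinAt Complex.sinh
      ((Complex.cosh w) • (1 : ℂ →L[ℝ] ℂ)) sinhStrip w := fun w _ =>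
    ((Complex.hasDerivAt_sinh w).complexToReal_fderiv).hasFDerivWithinAt
  have hdet : ∀ w : ℂ, |((Complex.cosh w) • (1 : ℂ →L[ℝ] ℂ)).det| =
      Complex.normSq (Complex.cosh w) := by
    intro w
    have : ((Complex.cosh w) • (1 : ℂ →L[ℝ] ℂ)).det = Algebra.norm ℝ (Complex.cosh w) := by
      rw [Algebra.norm_apply, ContinuousLinearMap.det]
      congr 1
    rw [this, Algebra.norm_complex_eq]
    exact abs_of_nonneg (Complex.normSq_nonneg _)
  have hI := (integrableOn_image_iff_integrableOn_abs_det_fderiv_smul volume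
    measurableSet_sinhStrip hderiv injOn_sinh_sinhStrip
    (fun z : ℂ => Real.exp (-b * ‖z‖ ^ 2))).mp hint.integrableOn
  have hE := integral_image_eq_integral_abs_det_fderiv_smul volume
    measurableSet_sinhStrip hderiv injOn_sinh_sinhStrip
    (fun z : ℂ => Real.exp (-b * ‖z‖ ^ 2))
  rw [setIntegral_congr_set image_sinh_sinhStrip_ae_eq_univ, setIntegral_univ, hgauss] at hE
  simp only [hdet, smul_eq_mul] at hI hE
  exact ⟨hI, hE.symm⟩

lemma normSq_cosh_eq (a b : ℝ) :
    Complex.normSq (Complex.cosh ⟨a, b⟩) = (Real.cosh (2 * a) + Real.cos (2 * b)) / 2 := by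
  have h : (⟨a, b⟩ : ℂ) = a + b * Complex.I := by apply Complex.ext <;> simp
  rw [h, Complex.cosh_add, Complex.cosh_mul_I, Complex.sinh_mul_I, Complex.normSq_apply,
    ← Complex.ofReal_cosh, ← Complex.ofReal_sinh, ← Complex.ofReal_cos, ← Complex.ofReal_sin]
  simp only [Complex.add_re, Complex.add_im, Complex.mul_re, Complex.mul_im, Complex.ofReal_re,
    Complex.ofReal_im, Complex.I_re, Complex.I_im]
  rw [Real.cosh_two_mul, Real.cos_two_mul]
  linear_combination (Real.sinh a ^ 2) * Real.sin_sq_add_cos_sq b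
    + (-(1 / 2) + Real.cos b ^ 2) * Real.cosh_sq a

lemma norm_sinh_sq_eq (a b : ℝ) :
    ‖Complex.sinh ⟨a, b⟩‖ ^ 2 = (Real.cosh (2 * a) - Real.cos (2 * b)) / 2 := by
  have h : (⟨a, b⟩ : ℂ) = a + b * Complex.I := by apply Complex.ext <;> simp
  rw [← Complex.normSq_eq_norm_sq, h, Complex.sinh_add, Complex.cosh_mul_I, Complex.sinh_mul_I,
    Complex.normSq_apply,
    ← Complex.ofReal_cosh, ← Complex.ofReal_sinh, ← Complex.ofReal_cos, ← Complex.ofReal_sin]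
  simp only [Complex.add_re, Complex.add_im, Complex.mul_re, Complex.mul_im, Complex.ofReal_re,
    Complex.ofReal_im, Complex.I_re, Complex.I_im]
  rw [Real.cosh_two_mul, Real.cos_two_mul]
  linear_combination (Real.cosh a ^ 2) * Real.sin_sq_add_cos_sq b
    + (1 / 2 - Real.cos b ^ 2) * Real.cosh_sq a

lemma besselI_eq_integral_symm (n : ℕ) (x : ℝ) :
    ∫ θ in (-π)..π, Real.exp (x * Real.cos θ) * Real.cos (n * θ) = 2 * π * besselI n x := by
  have hper : Function.Periodic
      (fun θ : ℝ => Real.exp (x * Real.cos θ) * Real.cos (n * θ)) (2 * π) := by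
    intro θ
    simp only [Real.cos_add_two_pi, mul_add, Real.cos_add_nat_mul_two_pi]
  have h := hper.intervalIntegral_add_eq (-π) 0
  rw [show -π + 2 * π = π by ring, zero_add] at h
  rw [h, besselI]
  field_simp

lemma integral_cosh_add_cos_mul_exp (t c : ℝ) :
    ∫ b in Set.Ioo (-(π / 2)) (π / 2),
      (c + Real.cos (2 * b)) / 2 * Real.exp (-(4 * t) * ((c - Real.cos (2 * b)) / 2)) =
    π / 2 * (Real.exp (-(2 * t) * c) * (besselI 1 (2 * t) + c * besselI 0 (2 * t))) := by
  have hpi := Real.pi_pos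
  rw [← integral_Ioc_eq_integral_Ioo, ← intervalIntegral.integral_of_le (by linarith)]
  rw [intervalIntegral.integral_comp_mul_left (fun y => (c + Real.cos y) / 2 *
    Real.exp (-(4 * t) * ((c - Real.cos y) / 2))) two_ne_zero]
  rw [show 2 * -(π / 2) = -π by ring, show 2 * (π / 2) = π by ring]
  have hsplit : ∀ y : ℝ, (c + Real.cos y) / 2 * Real.exp (-(4 * t) * ((c - Real.cos y) / 2)) =
      Real.exp (-(2 * t) * c) / 2 *
        (Real.exp (2 * t * Real.cos y) * Real.cos ((1 : ℕ) * y) +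
          c * (Real.exp (2 * t * Real.cos y) * Real.cos ((0 : ℕ) * y))) := by
    intro y
    rw [show -(4 * t) * ((c - Real.cos y) / 2) = -(2 * t) * c + 2 * t * Real.cos y by ring,
      Real.exp_add]
    simp
    ring
  simp only [hsplit]
  rw [intervalIntegral.integral_const_mul, intervalIntegral.integral_add
    (Continuous.intervalIntegrable (by fun_prop) _ _)
    (Continuous.intervalIntegrable (by fun_prop) _ _), intervalIntegral.integral_const_mul,
    besselI_eq_integral_symm, besselI_eq_integral_symm, smul_eq_mul]
  ring

/-- Integral form of the Wronskian identity `x (I₀ K₁ + I₁ K₀) = 1` at `x = 2 t`. -/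
lemma integral_exp_neg_cosh_mul_besselI {t : ℝ} (ht : 0 < t) :
    Integrable (fun a : ℝ => Real.exp (-(2 * t) * Real.cosh (2 * a)) *
        (besselI 1 (2 * t) + Real.cosh (2 * a) * besselI 0 (2 * t))) ∧
      ∫ a : ℝ, Real.exp (-(2 * t) * Real.cosh (2 * a)) *
        (besselI 1 (2 * t) + Real.cosh (2 * a) * besselI 0 (2 * t)) = 1 / (2 * t) := by
  have hpi := Real.pi_pos
  obtain ⟨hI, hE⟩ := gaussian_comp_sinh (b := 4 * t) (by linarith)
  have hmp := Complex.volume_preserving_equiv_real_prod.symm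
  have hemb := Complex.measurableEquivRealProd.symm.measurableEmbedding
  have hpre : Complex.measurableEquivRealProd.symm ⁻¹' sinhStrip =
      Set.univ ×ˢ Set.Ioo (-(π / 2)) (π / 2) := by
    ext p
    simp [sinhStrip, Complex.measurableEquivRealProd_symm_apply]
  rw [← hmp.integrableOn_comp_preimage hemb, hpre] at hI
  rw [← hmp.setIntegral_preimage_emb hemb, hpre] at hE
  simp only [Function.comp_def, Complex.measurableEquivRealProd_symm_apply, normSq_cosh_eq,
    norm_sinh_sq_eq] at hI hE
  rw [Measure.volume_eq_prod] at hI hE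
  rw [setIntegral_prod _ hI, setIntegral_univ] at hE
  rw [IntegrableOn, ← Measure.prod_restrict, Measure.restrict_univ] at hI
  have hI' := hI.integral_prod_left
  simp only [integral_cosh_add_cos_mul_exp] at hI' hE
  rw [integral_const_mul] at hE
  refine ⟨(integrable_const_mul_iff (isUnit_iff_ne_zero.mpr (by positivity)) _).mp hI', ?_⟩
  have h2 : π / 2 * (1 / (2 * t)) = π / (4 * t) := by field_simp; norm_num
  exact mul_left_cancel₀ (by positivity : π / 2 ≠ 0) (hE.trans h2.symm)

lemma Pdens_sigmoid (t a : ℝ) :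
    |2 * (Real.sigmoid (2 * a) * (1 - Real.sigmoid (2 * a)))| * Pdens t (Real.sigmoid (2 * a)) =
      2 * t * (Real.exp (-(2 * t) * Real.cosh (2 * a)) *
        (besselI 1 (2 * t) + Real.cosh (2 * a) * besselI 0 (2 * t))) := by
  have h0 := Real.sigmoid_pos (2 * a)
  have h1 : 0 < 1 - Real.sigmoid (2 * a) := sub_pos.mpr (Real.sigmoid_lt_one _)
  have hs := Real.sigmoid_mul_rexp_neg (2 * a)
  rw [Real.sigmoid_neg] at hs
  have hq : (1 - Real.sigmoid (2 * a)) / Real.sigmoid (2 * a) = Real.exp (-(2 * a)) := by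
    rw [← hs]; field_simp
  have hq' : Real.sigmoid (2 * a) / (1 - Real.sigmoid (2 * a)) = Real.exp (2 * a) := by
    rw [← inv_div, hq, Real.exp_neg, inv_inv]
  have hsum : Real.exp (2 * a) + Real.exp (-(2 * a)) = 2 * Real.cosh (2 * a) := by
    rw [Real.cosh_eq]; ring
  rw [Pdens, hq, hq', hsum, abs_of_pos (by positivity),
    show -t * (2 * Real.cosh (2 * a)) = -(2 * t) * Real.cosh (2 * a) by ring]
  field_simp

/-- For every `t > 0`, `P_t` is a probability density on `(0,1)`. -/
theorem Pdens_probability_density (t : ℝ) (ht : 0 < t) :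
    IntegrableOn (Pdens t) (Set.Ioo (0:ℝ) 1) volume ∧
      ∫ p in Set.Ioo (0:ℝ) 1, Pdens t p = 1 := by
  obtain ⟨hI, hE⟩ := integral_exp_neg_cosh_mul_besselI ht
  have himage : (fun a : ℝ => Real.sigmoid (2 * a)) '' Set.univ = Set.Ioo 0 1 := by
    rw [Set.image_univ, ← Real.range_sigmoid]
    exact (mul_left_surjective₀ (two_ne_zero' ℝ)).range_comp Real.sigmoid
  have hderiv : ∀ a ∈ Set.univ, HasDerivWithinAt (fun a : ℝ => Real.sigmoid (2 * a))
      (2 * (Real.sigmoid (2 * a) * (1 - Real.sigmoid (2 * a)))) Set.univ a := by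
    intro a _
    have h := (Real.hasDerivAt_sigmoid (2 * a)).comp a ((hasDerivAt_id a).const_mul 2)
    exact (h.congr_deriv (by ring)).hasDerivWithinAt
  have hinj : Set.InjOn (fun a : ℝ => Real.sigmoid (2 * a)) Set.univ :=
    (Real.sigmoid_injective.comp (mul_right_injective₀ two_ne_zero)).injOn
  rw [← himage, integrableOn_image_iff_integrableOn_abs_deriv_smul .univ hderiv hinj,
    integral_image_eq_integral_abs_deriv_smul .univ hderiv hinj]
  simp only [smul_eq_mul, Pdens_sigmoid, integrableOn_univ, setIntegral_univ]
  refine ⟨hI.const_mul _, ?_⟩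
  rw [integral_const_mul, hE]
  field_simp
end

section
/- For every t > 0, J₀(t) = 2 K₀(2t), i.e. ∫₀¹ (1/(p(1−p))) e^{−t(p/(1−p)+(1−p)/p)} dp = 2 ∫₀^∞ e^{−2t cosh α} dα. -/
open MeasureTheory Real

lemma hasDerivAt_log_sub_log_one_sub {p : ℝ} (hp : p ∈ Set.Ioo (0:ℝ) 1) :
    HasDerivAt (fun p : ℝ => log p - log (1 - p)) (1 / (p * (1 - p))) p := by
  have h0 : p ≠ 0 := hp.1.ne'
  have h1 : 1 - p ≠ 0 := (sub_pos.2 hp.2).ne'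
  refine ((hasDerivAt_log h0).sub (((hasDerivAt_id' p).const_sub 1).log h1)).congr_deriv ?_
  field_simp
  ring

lemma exp_log_sub_log_one_sub {p : ℝ} (hp : p ∈ Set.Ioo (0:ℝ) 1) :
    exp (log p - log (1 - p)) = p / (1 - p) := by
  rw [exp_sub, exp_log hp.1, exp_log (sub_pos.2 hp.2)]

lemma injOn_log_sub_log_one_sub :
    Set.InjOn (fun p : ℝ => log p - log (1 - p)) (Set.Ioo 0 1) := by
  intro p hp q hq h
  have h' := congrArg exp h
  simp only [exp_log_sub_log_one_sub hp, exp_log_sub_log_one_sub hq] at h'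
  rw [div_eq_div_iff (sub_pos.2 hp.2).ne' (sub_pos.2 hq.2).ne'] at h'
  linarith

lemma image_log_sub_log_one_sub :
    (fun p : ℝ => log p - log (1 - p)) '' Set.Ioo 0 1 = Set.univ := by
  refine Set.eq_univ_of_forall fun x => ?_
  have hx := exp_pos x
  have hp : exp x / (1 + exp x) ∈ Set.Ioo (0:ℝ) 1 :=
    ⟨by positivity, (div_lt_one (by positivity)).2 (by linarith)⟩
  refine ⟨_, hp, exp_injective ?_⟩
  simp only [exp_log_sub_log_one_sub hp]
  have : 1 - exp x / (1 + exp x) = 1 / (1 + exp x) := by field_simp; ring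
  rw [this]
  field_simp

lemma two_mul_cosh_log_sub_log_one_sub {p : ℝ} (hp : p ∈ Set.Ioo (0:ℝ) 1) :
    2 * cosh (log p - log (1 - p)) = p / (1 - p) + (1 - p) / p := by
  rw [cosh_eq, exp_neg, exp_log_sub_log_one_sub hp, inv_div]
  ring

/-- For every `t > 0`, `J₀(t) = 2 K₀(2t)`:
`∫₀¹ (1/(p(1−p))) e^{−t(p/(1−p)+(1−p)/p)} dp = 2 ∫₀^∞ e^{−2t cosh α} dα`. -/
theorem J0_eq_two_K0 (t : ℝ) (ht : 0 < t) :
    ∫ p in Set.Ioo (0:ℝ) 1, (1 / (p * (1 - p))) * Real.exp (-t * (p / (1 - p) + (1 - p) / p))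
      = 2 * ∫ α in Set.Ioi (0:ℝ), Real.exp (-(2 * t) * Real.cosh α) := by
  have h := integral_image_eq_integral_abs_deriv_smul measurableSet_Ioo
    (fun p hp => (hasDerivAt_log_sub_log_one_sub hp).hasDerivWithinAt)
    injOn_log_sub_log_one_sub (fun x => exp (-(2 * t) * cosh x))
  rw [image_log_sub_log_one_sub, setIntegral_univ] at h
  rw [← integral_comp_abs (f := fun x => exp (-(2 * t) * cosh x))]
  simp only [cosh_abs]
  rw [h]
  refine setIntegral_congr_fun measurableSet_Ioo fun p hp => ?_
  have hpos : 0 < 1 / (p * (1 - p)) := one_div_pos.2 (mul_pos hp.1 (sub_pos.2 hp.2))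
  simp only [smul_eq_mul]
  rw [abs_of_pos hpos, ← two_mul_cosh_log_sub_log_one_sub hp]
  ring_nf
end

section
/- For every t > 0, J₁(t) = 2 K₁(2t), i.e. (1/2) ∫₀¹ (1/(p(1−p))) e^{−t(p/(1−p)+(1−p)/p)} (p/(1−p)+(1−p)/p) dp = 2 ∫₀^∞ e^{−2t cosh α} cosh α dα. -/
open MeasureTheory Real

/-- For every `t > 0`, `J₁(t) = 2 K₁(2t)`:
`(1/2) ∫₀¹ (1/(p(1−p))) e^{−t(p/(1−p)+(1−p)/p)} (p/(1−p)+(1−p)/p) dp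
   = 2 ∫₀^∞ e^{−2t cosh α} cosh α dα`. -/
theorem J1_eq_two_K1 (t : ℝ) (ht : 0 < t) :
    (1 / 2) * ∫ p in Set.Ioo (0:ℝ) 1,
        (1 / (p * (1 - p))) * Real.exp (-t * (p / (1 - p) + (1 - p) / p))
          * (p / (1 - p) + (1 - p) / p)
      = 2 * ∫ α in Set.Ioi (0:ℝ), Real.exp (-(2 * t) * Real.cosh α) * Real.cosh α := by
  rw [← integral_comp_abs (f := fun α ↦ Real.exp (-(2 * t) * Real.cosh α) * Real.cosh α),
    ← range_sigmoid, ← Set.image_univ,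
    integral_image_eq_integral_abs_deriv_smul MeasurableSet.univ
      (fun x _ ↦ (hasDerivAt_sigmoid x).hasDerivWithinAt) sigmoid_injective.injOn,
    setIntegral_univ, ← integral_const_mul]
  congr 1 with x
  have h0 := sigmoid_pos x
  have h1 : 0 < 1 - sigmoid x := sub_pos.2 (sigmoid_lt_one x)
  have hsum : sigmoid x / (1 - sigmoid x) + (1 - sigmoid x) / sigmoid x = 2 * cosh x := by
    have he := exp_pos x
    have hs : sigmoid x = exp x / (1 + exp x) := by
      rw [sigmoid_def, exp_neg]
      field_simp
      ring
    have hc : 1 - sigmoid x = 1 / (1 + exp x) := by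
      rw [hs]
      field_simp
      ring
    rw [hc, hs, cosh_eq, exp_neg]
    field_simp
  rw [hsum, abs_of_pos (mul_pos h0 h1), cosh_abs, smul_eq_mul,
    show -t * (2 * cosh x) = -(2 * t) * cosh x by ring]
  field_simp
end

section
/- For t > 0: if I₀(2t)/(I₀(2t)+I₁(2t)) > 2t − 1/2 then p = 1/2 is a strict local minimum of the density P_t on (0,1), while if I₀(2t)/(I₀(2t)+I₁(2t)) < 2t − 1/2 then p = 1/2 is a strict local maximum of P_t. -/
open MeasureTheory Real

/-- A function with positive derivative at `a` exceeds its value at `a` just to the right. -/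
theorem eventually_lt_nhdsGT_of_hasDerivAt_pos {g : ℝ → ℝ} {a d : ℝ} (hg : HasDerivAt g d a)
    (hd : 0 < d) : ∀ᶠ w in nhdsWithin a (Set.Ioi a), g a < g w := by
  have hslope := (hasDerivWithinAt_iff_tendsto_slope' (Set.self_notMem_Ioi)).1
    (hg.hasDerivWithinAt (s := Set.Ioi a))
  filter_upwards [hslope.eventually (lt_mem_nhds hd), self_mem_nhdsWithin] with w hw haw
  rw [slope_def_field] at hw
  have haw' : 0 < w - a := sub_pos.2 haw
  have := (div_pos_iff_of_pos_right haw').1 hw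
  linarith

theorem besselI_zero_add_besselI_one_pos (x : ℝ) : 0 < besselI 0 x + besselI 1 x := by
  have hsum : besselI 0 x + besselI 1 x = (1 / (2 * Real.pi)) *
      ∫ θ in (0:ℝ)..(2 * Real.pi), Real.exp (x * Real.cos θ) * (1 + Real.cos θ) := by
    unfold besselI
    rw [← mul_add, ← intervalIntegral.integral_add]
    · congr 2
      ext θ
      simp
      ring
    · exact Continuous.intervalIntegrable (by fun_prop) _ _
    · exact Continuous.intervalIntegrable (by fun_prop) _ _
  rw [hsum]
  refine mul_pos (by positivity) ?_
  refine intervalIntegral.integral_pos (by positivity) (by fun_prop) ?_ ?_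
  · intro θ _
    have := Real.neg_one_le_cos θ
    exact mul_nonneg (Real.exp_pos _).le (by linarith)
  · refine ⟨0, ⟨le_rfl, by positivity⟩, ?_⟩
    rw [Real.cos_zero]
    positivity

/-- The density as a function of `w = 1 / (p (1 - p)) - 4`. -/
noncomputable def PdensProfile (t w : ℝ) : ℝ :=
  t * (w + 4) * Real.exp (-t * (2 + w)) *
    (besselI 1 (2 * t) + (1 / 2) * (2 + w) * besselI 0 (2 * t))

theorem Pdens_eq_PdensProfile (t : ℝ) {p : ℝ} (hp : p ∈ Set.Ioo (0:ℝ) 1) :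
    Pdens t p = PdensProfile t (1 / (p * (1 - p)) - 4) := by
  have h0 : p ≠ 0 := hp.1.ne'
  have h1 : 1 - p ≠ 0 := (sub_pos.2 hp.2).ne'
  have hu : p / (1 - p) + (1 - p) / p = 2 + (1 / (p * (1 - p)) - 4) := by
    field_simp
    ring
  unfold Pdens PdensProfile
  rw [hu]
  ring

theorem hasDerivAt_PdensProfile_zero (t : ℝ) :
    HasDerivAt (PdensProfile t)
      (2 * t * Real.exp (-t * 2) * (besselI 0 (2 * t) + besselI 1 (2 * t)) *
        (besselI 0 (2 * t) / (besselI 0 (2 * t) + besselI 1 (2 * t)) - (2 * t - 1 / 2))) 0 := by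
  have hA := (besselI_zero_add_besselI_one_pos (2 * t)).ne'
  have hid := hasDerivAt_id (0:ℝ)
  have h := (((hid.add_const 4).const_mul t).mul ((hid.const_add 2).const_mul (-t)).exp).mul
    ((((hid.const_add 2).const_mul (1 / 2)).mul_const (besselI 0 (2 * t))).const_add
      (besselI 1 (2 * t)))
  refine h.congr_deriv ?_
  rw [mul_assoc _ (besselI 0 (2 * t) + besselI 1 (2 * t)), mul_sub, mul_div_cancel₀ _ hA]
  simp only [id, Pi.mul_apply, zero_add, add_zero]
  ring

theorem tendsto_one_div_mul_one_sub :
    Filter.Tendsto (fun p : ℝ => 1 / (p * (1 - p)) - 4) (nhds (1 / 2)) (nhds 0) := by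
  have h : ContinuousAt (fun p : ℝ => 1 / (p * (1 - p)) - 4) (1 / 2) := by
    fun_prop (disch := norm_num)
  convert h.tendsto using 2
  norm_num

theorem one_div_mul_one_sub_pos {p : ℝ} (hp : p ∈ Set.Ioo (0:ℝ) 1) (hne : p ≠ 1 / 2) :
    0 < 1 / (p * (1 - p)) - 4 := by
  have hpq : 0 < p * (1 - p) := mul_pos hp.1 (sub_pos.2 hp.2)
  rw [sub_pos, lt_div_iff₀ hpq]
  nlinarith [sq_pos_of_ne_zero (sub_ne_zero.2 hne)]

/-- A property of `w = 1 / (p (1 - p)) - 4` valid for small `w > 0` holds for `p` near `1 / 2`. -/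
theorem exists_forall_near_half {q : ℝ → Prop}
    (hq : ∀ᶠ w in nhdsWithin 0 (Set.Ioi 0), q w) :
    ∃ ε > 0, ∀ p : ℝ, p ∈ Set.Ioo (0:ℝ) 1 → p ≠ 1 / 2 → |p - 1 / 2| < ε →
      q (1 / (p * (1 - p)) - 4) := by
  obtain ⟨ε, hε, h⟩ := Metric.eventually_nhds_iff.1
    (tendsto_one_div_mul_one_sub.eventually (eventually_nhdsWithin_iff.1 hq))
  exact ⟨ε, hε, fun p hp hne hlt => h hlt (one_div_mul_one_sub_pos hp hne)⟩

/-- If `I₀(2t)/(I₀(2t)+I₁(2t)) > 2t − 1/2` then `p = 1/2` is a strict local minimum of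
`P_t` on `(0,1)`; if `I₀(2t)/(I₀(2t)+I₁(2t)) < 2t − 1/2` it is a strict local maximum. -/
theorem Pdens_midpoint_strict_extremum (t : ℝ) (ht : 0 < t) :
    (besselI 0 (2 * t) / (besselI 0 (2 * t) + besselI 1 (2 * t)) > 2 * t - 1 / 2 →
      ∃ ε > 0, ∀ p : ℝ, p ∈ Set.Ioo (0:ℝ) 1 → p ≠ 1 / 2 → |p - 1 / 2| < ε →
        Pdens t (1 / 2) < Pdens t p) ∧
    (besselI 0 (2 * t) / (besselI 0 (2 * t) + besselI 1 (2 * t)) < 2 * t - 1 / 2 →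
      ∃ ε > 0, ∀ p : ℝ, p ∈ Set.Ioo (0:ℝ) 1 → p ≠ 1 / 2 → |p - 1 / 2| < ε →
        Pdens t p < Pdens t (1 / 2)) := by
  have hhalf : Pdens t (1 / 2) = PdensProfile t 0 := by
    rw [Pdens_eq_PdensProfile t (by norm_num)]
    norm_num
  have hc : 0 < 2 * t * Real.exp (-t * 2) * (besselI 0 (2 * t) + besselI 1 (2 * t)) :=
    mul_pos (by positivity) (besselI_zero_add_besselI_one_pos (2 * t))
  have hderiv := hasDerivAt_PdensProfile_zero t
  constructor
  · intro h
    obtain ⟨ε, hε, H⟩ := exists_forall_near_half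
      (eventually_lt_nhdsGT_of_hasDerivAt_pos hderiv (mul_pos hc (sub_pos.2 h)))
    refine ⟨ε, hε, fun p hp hne hlt => ?_⟩
    rw [hhalf, Pdens_eq_PdensProfile t hp]
    exact H p hp hne hlt
  · intro h
    obtain ⟨ε, hε, H⟩ := exists_forall_near_half
      (eventually_lt_nhdsGT_of_hasDerivAt_pos hderiv.neg
        (neg_pos.2 (mul_neg_of_pos_of_neg hc (sub_neg.2 h))))
    refine ⟨ε, hε, fun p hp hne hlt => ?_⟩
    rw [hhalf, Pdens_eq_PdensProfile t hp]
    exact neg_lt_neg_iff.1 (H p hp hne hlt)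
end

section
/- In the weak coupling limit, the family of densities P_t converges weakly to the measure (1/2)(δ₀ + δ₁) as t → 0⁺: for every continuous function f : [0,1] → ℝ, lim_{t→0⁺} ∫₀¹ P_t(p) f(p) dp = (f(0) + f(1))/2. -/
open MeasureTheory Real Filter

/-- The exponent of `Pdens`, up to the factor `-t`. -/
noncomputable def oddsSum (p : ℝ) : ℝ := p / (1 - p) + (1 - p) / p

/-- The part of the density `Pdens t` that concentrates at `1`. -/
noncomputable def endpointKernel (t p : ℝ) : ℝ :=
  t / (1 - p) ^ 2 * Real.exp (-t * oddsSum p)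

lemma oddsSum_one_sub (p : ℝ) : oddsSum (1 - p) = oddsSum p := by
  simp only [oddsSum, sub_sub_cancel, add_comm]

lemma continuous_besselI (n : ℕ) : Continuous (besselI n) := by
  unfold besselI
  refine continuous_const.mul ?_
  apply intervalIntegral.continuous_parametric_intervalIntegral_of_continuous'
  fun_prop

lemma besselI_zero_zero : besselI 0 0 = 1 := by
  simp only [besselI, zero_mul, Real.exp_zero, Nat.cast_zero, Real.cos_zero, mul_one,
    intervalIntegral.integral_const, sub_zero, smul_eq_mul]
  exact one_div_mul_cancel (by positivity)

lemma image_div_add_Ioi {t : ℝ} (ht : 0 < t) :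
    (fun v : ℝ => v / (t + v)) '' Set.Ioi 0 = Set.Ioo 0 1 := by
  ext p
  simp only [Set.mem_image, Set.mem_Ioi, Set.mem_Ioo]
  constructor
  · rintro ⟨v, hv, rfl⟩
    exact ⟨by positivity, by rw [div_lt_one (by positivity)]; linarith⟩
  · rintro ⟨h0, h1⟩
    have h2 : 0 < 1 - p := by linarith
    refine ⟨t * p / (1 - p), by positivity, ?_⟩
    field_simp
    ring

lemma injOn_div_add_Ioi {t : ℝ} (ht : 0 < t) :
    Set.InjOn (fun v : ℝ => v / (t + v)) (Set.Ioi 0) := by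
  intro a ha b hb hab
  simp only [Set.mem_Ioi] at ha hb
  have h1 : t + a ≠ 0 := by positivity
  have h2 : t + b ≠ 0 := by positivity
  have hab : a / (t + a) = b / (t + b) := hab
  rw [div_eq_div_iff h1 h2] at hab
  have : t * (a - b) = 0 := by linarith
  rcases mul_eq_zero.mp this with h | h <;> linarith

lemma hasDerivAt_div_add {t v : ℝ} (h : t + v ≠ 0) :
    HasDerivAt (fun v : ℝ => v / (t + v)) (t / (t + v) ^ 2) v := by
  refine ((hasDerivAt_id' v).div ((hasDerivAt_id' v).const_add t) h).congr_deriv ?_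
  ring

lemma abs_deriv_smul_endpointKernel {t v : ℝ} (ht : 0 < t) (hv : 0 < v) (g : ℝ → ℝ) :
    |t / (t + v) ^ 2| • (endpointKernel t (v / (t + v)) * g (v / (t + v))) =
      Real.exp (-v) * (Real.exp (-(t ^ 2 / v)) * g (v / (t + v))) := by
  have h1 : 1 - v / (t + v) = t / (t + v) := by field_simp; ring
  have h2 : -t * oddsSum (v / (t + v)) = -v + -(t ^ 2 / v) := by
    rw [oddsSum, h1]; field_simp; ring
  rw [endpointKernel, h1, h2, Real.exp_add, abs_of_pos (by positivity), smul_eq_mul]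
  field_simp

lemma div_add_mem_Icc {t v : ℝ} (ht : 0 < t) (hv : 0 < v) : v / (t + v) ∈ Set.Icc (0 : ℝ) 1 :=
  ⟨by positivity, by rw [div_le_one (by positivity)]; linarith⟩

lemma aestronglyMeasurable_endpointKernel_subst {g : ℝ → ℝ}
    (hg : ContinuousOn g (Set.Icc (0 : ℝ) 1)) {t : ℝ} (ht : 0 < t) :
    AEStronglyMeasurable
      (fun v => Real.exp (-v) * (Real.exp (-(t ^ 2 / v)) * g (v / (t + v))))
      (volume.restrict (Set.Ioi 0)) := by
  refine ContinuousOn.aestronglyMeasurable ?_ measurableSet_Ioi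
  refine (Real.continuous_exp.comp continuous_neg).continuousOn.mul (ContinuousOn.mul ?_ ?_)
  · refine Real.continuous_exp.comp_continuousOn
      ((continuousOn_const.div continuousOn_id fun v hv => ?_).neg)
    exact ne_of_gt hv
  · refine hg.comp (continuousOn_id.div (by fun_prop) fun v hv => ?_)
      fun v hv => div_add_mem_Icc ht hv
    exact ne_of_gt (add_pos ht hv)

lemma norm_endpointKernel_subst_le {g : ℝ → ℝ} {C : ℝ} (hC : ∀ p ∈ Set.Icc (0 : ℝ) 1, ‖g p‖ ≤ C)
    {t v : ℝ} (ht : 0 < t) (hv : 0 < v) :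
    ‖Real.exp (-v) * (Real.exp (-(t ^ 2 / v)) * g (v / (t + v)))‖ ≤ Real.exp (-v) * C := by
  rw [norm_mul, norm_mul, Real.norm_of_nonneg (Real.exp_nonneg _),
    Real.norm_of_nonneg (Real.exp_nonneg _)]
  gcongr
  calc _ ≤ 1 * ‖g (v / (t + v))‖ := by
        gcongr
        exact Real.exp_le_one_iff.mpr (neg_nonpos.mpr (by positivity))
    _ ≤ C := by rw [one_mul]; exact hC _ (div_add_mem_Icc ht hv)

lemma integrableOn_endpointKernel_mul {g : ℝ → ℝ} (hg : ContinuousOn g (Set.Icc (0 : ℝ) 1))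
    {t : ℝ} (ht : 0 < t) :
    IntegrableOn (fun p => endpointKernel t p * g p) (Set.Ioo 0 1) := by
  obtain ⟨C, hC⟩ := isCompact_Icc.exists_bound_of_continuousOn hg
  rw [← image_div_add_Ioi ht, integrableOn_image_iff_integrableOn_abs_deriv_smul measurableSet_Ioi
    (fun v hv => (hasDerivAt_div_add (add_pos ht hv).ne').hasDerivWithinAt) (injOn_div_add_Ioi ht),
    integrableOn_congr_fun
      (fun v (hv : v ∈ Set.Ioi 0) => abs_deriv_smul_endpointKernel ht hv g) measurableSet_Ioi]
  refine ((integrableOn_exp_neg_Ioi 0).mul_const C).mono'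
    (aestronglyMeasurable_endpointKernel_subst hg ht) ?_
  filter_upwards [ae_restrict_mem measurableSet_Ioi] with v hv
  exact norm_endpointKernel_subst_le hC ht hv

lemma setIntegral_endpointKernel_mul (g : ℝ → ℝ) {t : ℝ} (ht : 0 < t) :
    ∫ p in Set.Ioo (0 : ℝ) 1, endpointKernel t p * g p =
      ∫ v in Set.Ioi (0 : ℝ), Real.exp (-v) * (Real.exp (-(t ^ 2 / v)) * g (v / (t + v))) := by
  rw [← image_div_add_Ioi ht, integral_image_eq_integral_abs_deriv_smul measurableSet_Ioi
    (fun v hv => (hasDerivAt_div_add (add_pos ht hv).ne').hasDerivWithinAt) (injOn_div_add_Ioi ht)]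
  exact setIntegral_congr_fun measurableSet_Ioi
    fun v hv => abs_deriv_smul_endpointKernel ht hv g

lemma tendsto_setIntegral_endpointKernel_mul {g : ℝ → ℝ}
    (hg : ContinuousOn g (Set.Icc (0 : ℝ) 1)) :
    Tendsto (fun t : ℝ => ∫ p in Set.Ioo (0 : ℝ) 1, endpointKernel t p * g p)
      (nhdsWithin 0 (Set.Ioi 0)) (nhds (g 1)) := by
  obtain ⟨C, hC⟩ := isCompact_Icc.exists_bound_of_continuousOn hg
  have hpos : ∀ᶠ t : ℝ in nhdsWithin 0 (Set.Ioi 0), 0 < t := self_mem_nhdsWithin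
  have hlim : g 1 = ∫ v in Set.Ioi (0 : ℝ), Real.exp (-v) * g 1 := by
    rw [integral_mul_const, integral_exp_neg_Ioi_zero, one_mul]
  rw [hlim]
  refine Tendsto.congr' (hpos.mono fun t ht => (setIntegral_endpointKernel_mul g ht).symm) ?_
  refine tendsto_integral_filter_of_dominated_convergence (fun v => Real.exp (-v) * C)
    (hpos.mono fun t ht => aestronglyMeasurable_endpointKernel_subst hg ht)
    (hpos.mono fun t ht => ?_) ((integrableOn_exp_neg_Ioi 0).mul_const C) ?_
  · filter_upwards [ae_restrict_mem measurableSet_Ioi] with v hv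
    exact norm_endpointKernel_subst_le hC ht hv
  · filter_upwards [ae_restrict_mem measurableSet_Ioi] with v hv
    have hv : 0 < v := hv
    refine Tendsto.const_mul _ ?_
    have h1 : Tendsto (fun t : ℝ => Real.exp (-(t ^ 2 / v))) (nhdsWithin 0 (Set.Ioi 0))
        (nhds 1) := by
      have : Continuous fun t : ℝ => Real.exp (-(t ^ 2 / v)) := by fun_prop
      simpa using (this.tendsto 0).mono_left nhdsWithin_le_nhds
    have h2 : Tendsto (fun t : ℝ => v / (t + v)) (nhdsWithin 0 (Set.Ioi 0)) (nhds 1) := by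
      have : ContinuousAt (fun t : ℝ => v / (t + v)) 0 :=
        continuousAt_const.div (by fun_prop) (by simpa using hv.ne')
      simpa [hv.ne'] using this.tendsto.mono_left (nhdsWithin_le_nhds (s := Set.Ioi 0))
    have h3 : Tendsto (fun t : ℝ => g (v / (t + v))) (nhdsWithin 0 (Set.Ioi 0)) (nhds (g 1)) :=
      (hg 1 (by simp)).tendsto.comp (tendsto_nhdsWithin_iff.mpr
        ⟨h2, hpos.mono fun t ht => div_add_mem_Icc ht hv⟩)
    simpa using h1.mul h3

lemma continuousOn_comp_one_sub {g : ℝ → ℝ} (hg : ContinuousOn g (Set.Icc (0 : ℝ) 1)) :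
    ContinuousOn (fun p => g (1 - p)) (Set.Icc (0 : ℝ) 1) :=
  hg.comp (by fun_prop) fun p hp => ⟨by linarith [hp.2], by linarith [hp.1]⟩

lemma image_one_sub_Ioo : (fun p : ℝ => 1 - p) '' Set.Ioo 0 1 = Set.Ioo 0 1 := by
  simp

lemma integrableOn_endpointKernel_one_sub_mul {g : ℝ → ℝ}
    (hg : ContinuousOn g (Set.Icc (0 : ℝ) 1)) {t : ℝ} (ht : 0 < t) :
    IntegrableOn (fun p => endpointKernel t (1 - p) * g p) (Set.Ioo 0 1) := by
  rw [← image_one_sub_Ioo, integrableOn_image_iff_integrableOn_abs_deriv_smul measurableSet_Ioo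
    (fun p _ => ((hasDerivAt_id' p).const_sub 1).hasDerivWithinAt) sub_right_injective.injOn]
  simpa using integrableOn_endpointKernel_mul (continuousOn_comp_one_sub hg) ht

lemma setIntegral_endpointKernel_one_sub_mul (g : ℝ → ℝ) (t : ℝ) :
    ∫ p in Set.Ioo (0 : ℝ) 1, endpointKernel t (1 - p) * g p =
      ∫ p in Set.Ioo (0 : ℝ) 1, endpointKernel t p * g (1 - p) := by
  conv_lhs => rw [← image_one_sub_Ioo, integral_image_eq_integral_abs_deriv_smul measurableSet_Ioo
    (fun p _ => ((hasDerivAt_id' p).const_sub 1).hasDerivWithinAt) sub_right_injective.injOn]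
  simp

lemma tendsto_setIntegral_endpointKernel_one_sub_mul {g : ℝ → ℝ}
    (hg : ContinuousOn g (Set.Icc (0 : ℝ) 1)) :
    Tendsto (fun t : ℝ => ∫ p in Set.Ioo (0 : ℝ) 1, endpointKernel t (1 - p) * g p)
      (nhdsWithin 0 (Set.Ioi 0)) (nhds (g 0)) := by
  simp only [setIntegral_endpointKernel_one_sub_mul]
  simpa using tendsto_setIntegral_endpointKernel_mul (continuousOn_comp_one_sub hg)

lemma Pdens_mul_eq (f : ℝ → ℝ) (t : ℝ) {p : ℝ} (hp : p ∈ Set.Ioo (0 : ℝ) 1) :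
    Pdens t p * f p =
      besselI 1 (2 * t) * (endpointKernel t p * ((1 - p) * f p) +
        endpointKernel t (1 - p) * (p * f p)) +
      besselI 0 (2 * t) / 2 * (endpointKernel t p * f p + endpointKernel t (1 - p) * f p) := by
  have h0 : p ≠ 0 := hp.1.ne'
  have h1 : 1 - p ≠ 0 := (sub_pos.mpr hp.2).ne'
  simp only [Pdens, endpointKernel, oddsSum_one_sub, sub_sub_cancel]
  rw [← oddsSum]
  generalize Real.exp (-t * oddsSum p) = e
  rw [oddsSum]
  field_simp
  ring

/-- Weak convergence of `P_t` to `(1/2)(δ₀ + δ₁)` as `t → 0⁺`: for every continuous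
`f : [0,1] → ℝ`, `∫₀¹ P_t(p) f(p) dp → (f(0) + f(1))/2`. -/
theorem Pdens_weak_limit (f : ℝ → ℝ) (hf : ContinuousOn f (Set.Icc (0:ℝ) 1)) :
    Tendsto (fun t : ℝ => ∫ p in Set.Ioo (0:ℝ) 1, Pdens t p * f p)
      (nhdsWithin 0 (Set.Ioi (0:ℝ))) (nhds ((f 0 + f 1) / 2)) := by
  have hf₁ : ContinuousOn (fun p => (1 - p) * f p) (Set.Icc 0 1) :=
    ContinuousOn.mul (by fun_prop) hf
  have hf₂ : ContinuousOn (fun p => p * f p) (Set.Icc 0 1) := continuousOn_id.mul hf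
  have hI (n : ℕ) : Tendsto (fun t : ℝ => besselI n (2 * t)) (nhdsWithin 0 (Set.Ioi 0))
      (nhds (besselI n 0)) := by
    have : Continuous fun t : ℝ => besselI n (2 * t) :=
      (continuous_besselI n).comp (by fun_prop)
    simpa using (this.tendsto 0).mono_left nhdsWithin_le_nhds
  have hlim := ((hI 1).mul ((tendsto_setIntegral_endpointKernel_mul hf₁).add
    (tendsto_setIntegral_endpointKernel_one_sub_mul hf₂))).add
    (((hI 0).div_const 2).mul ((tendsto_setIntegral_endpointKernel_mul hf).add
      (tendsto_setIntegral_endpointKernel_one_sub_mul hf)))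
  have hval : besselI 1 0 * ((1 - 1) * f 1 + 0 * f 0) + besselI 0 0 / 2 * (f 1 + f 0) =
      (f 0 + f 1) / 2 := by
    rw [besselI_zero_zero]; ring
  rw [hval] at hlim
  refine hlim.congr' ?_
  filter_upwards [self_mem_nhdsWithin] with t ht
  have i₁ := integrableOn_endpointKernel_mul hf₁ ht
  have i₂ := integrableOn_endpointKernel_one_sub_mul hf₂ ht
  have i₃ := integrableOn_endpointKernel_mul hf ht
  have i₄ := integrableOn_endpointKernel_one_sub_mul hf ht
  rw [setIntegral_congr_fun measurableSet_Ioo fun p hp => Pdens_mul_eq f t hp,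
    ← integral_add i₁ i₂, ← integral_add i₃ i₄, ← integral_const_mul, ← integral_const_mul]
  exact (integral_add ((i₁.add i₂).const_mul _) ((i₃.add i₄).const_mul _)).symm
end

section
/- For every fixed t > 0, the sequence of integrals I_{0,N}(t) converges as N → ∞ and lim_{N→∞} I_{0,N}(t) = 2t · I₁(2t), where I₁ is the modified Bessel function of the first kind given by its integral representation. -/
open MeasureTheory Real Filter Complex

/-- `U_{0,N}`. -/
noncomputable def U0 (t : ℝ) (N : ℕ) (R₁ R₂ θ : ℝ) : ℂ :=
  ((t * Real.sqrt (R₁ * R₂) : ℝ) : ℂ) *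
      ((R₁ : ℂ) * Complex.exp (-(θ : ℂ) * Complex.I) + (R₂ : ℂ) * Complex.exp ((θ : ℂ) * Complex.I))
    + ((t ^ 2 / (N : ℝ) * (R₁ + R₂) : ℝ) : ℂ)

/-- `U_{1,N}`. -/
noncomputable def U1 (t : ℝ) (N : ℕ) (R₁ R₂ θ : ℝ) : ℂ :=
  ((t * ((N : ℝ) / ((N : ℝ) - 1)) * (R₁ * R₂) : ℝ) : ℂ)
    + ((t ^ 2 / ((N : ℝ) - 1) * Real.sqrt (R₁ * R₂) : ℝ) : ℂ) *
        (Complex.exp ((θ : ℂ) * Complex.I) + Complex.exp (-(θ : ℂ) * Complex.I))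
    - ((t ^ 2 / (N : ℝ) * Real.sqrt (R₁ * R₂) : ℝ) : ℂ) * Complex.exp ((θ : ℂ) * Complex.I)
    + ((t ^ 3 / ((N : ℝ) ^ 2 * ((N : ℝ) - 1)) : ℝ) : ℂ)

/-- `U_{2,N}`: as `U_{1,N}` with `e^{iθ}` replaced by `e^{−iθ}` in the third term. -/
noncomputable def U2 (t : ℝ) (N : ℕ) (R₁ R₂ θ : ℝ) : ℂ :=
  ((t * ((N : ℝ) / ((N : ℝ) - 1)) * (R₁ * R₂) : ℝ) : ℂ)
    + ((t ^ 2 / ((N : ℝ) - 1) * Real.sqrt (R₁ * R₂) : ℝ) : ℂ) *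
        (Complex.exp ((θ : ℂ) * Complex.I) + Complex.exp (-(θ : ℂ) * Complex.I))
    - ((t ^ 2 / (N : ℝ) * Real.sqrt (R₁ * R₂) : ℝ) : ℂ) * Complex.exp (-(θ : ℂ) * Complex.I)
    + ((t ^ 3 / ((N : ℝ) ^ 2 * ((N : ℝ) - 1)) : ℝ) : ℂ)

/-- The three functions `U_{j,N}`, `j = 0, 1, 2`. -/
noncomputable def Ufun (t : ℝ) (N : ℕ) : Fin 3 → ℝ → ℝ → ℝ → ℂ := ![U0 t N, U1 t N, U2 t N]

/-- `F_{j,N}(R₁,R₂)`. -/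
noncomputable def Ffun (t : ℝ) (N : ℕ) (j : Fin 3) (R₁ R₂ : ℝ) : ℂ :=
  (((R₁ * R₂) ^ 2)⁻¹ * (1 / (2 * Real.pi)) : ℝ) *
    ∫ θ in (0:ℝ)..(2 * Real.pi),
      (1 + (t : ℂ) * Complex.exp ((θ : ℂ) * Complex.I) / ((N : ℂ) * (Real.sqrt (R₁ * R₂) : ℝ))) ^ (N - 2) *
      (1 + (t : ℂ) * Complex.exp (-(θ : ℂ) * Complex.I) / ((N : ℂ) * (Real.sqrt (R₁ * R₂) : ℝ))) ^ (N - 2) *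
      Ufun t N j R₁ R₂ θ

/-- `I_{j,N}(t)`. -/
noncomputable def Ifun (t : ℝ) (N : ℕ) (j : Fin 3) : ℂ :=
  (((N : ℝ) / (2 * Real.pi) : ℝ) : ℂ) *
    ∫ R in (Set.Ioi (0:ℝ)) ×ˢ (Set.Ioi (0:ℝ)),
      ((Real.exp (-(N : ℝ) * (R.1 - 1 - Real.log R.1)) *
          Real.exp (-(N : ℝ) * (R.2 - 1 - Real.log R.2)) : ℝ) : ℂ) * Ffun t N j R.1 R.2

theorem integral_exp_int_mul_I (n : ℤ) :
    ∫ θ in (0:ℝ)..(2 * Real.pi), Complex.exp ((n : ℂ) * Complex.I * (θ : ℂ)) =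
      if n = 0 then 2 * (Real.pi : ℂ) else 0 := by
  split_ifs with h
  · simp [h]
  · have hc : (n : ℂ) * Complex.I ≠ 0 := by simp [h]
    rw [integral_exp_mul_complex hc]
    have : Complex.exp ((n : ℂ) * Complex.I * ((2 * Real.pi : ℝ) : ℂ)) = 1 := by
      rw [← Complex.exp_int_mul_two_pi_mul_I n]
      push_cast
      ring_nf
    rw [this]
    simp

theorem integral_trigPoly_mul_trigPoly (a b : ℕ → ℂ) (n d : ℕ) {e : ℤ} (he : e ≠ 0) :
    ∫ θ in (0:ℝ)..(2 * Real.pi),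
      (∑ j ∈ Finset.range (n + d), a j * Complex.exp ((e * θ : ℂ) * Complex.I) ^ j) *
      (∑ k ∈ Finset.range n, b k * Complex.exp (-(e * θ : ℂ) * Complex.I) ^ k) *
      Complex.exp (-(e * θ : ℂ) * Complex.I) ^ d =
    2 * Real.pi * ∑ k ∈ Finset.range n, a (k + d) * b k := by
  have key : ∀ θ : ℝ,
      (∑ j ∈ Finset.range (n + d), a j * Complex.exp ((e * θ : ℂ) * Complex.I) ^ j) *
      (∑ k ∈ Finset.range n, b k * Complex.exp (-(e * θ : ℂ) * Complex.I) ^ k) *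
      Complex.exp (-(e * θ : ℂ) * Complex.I) ^ d =
      ∑ k ∈ Finset.range n, ∑ j ∈ Finset.range (n + d), a j * b k *
        Complex.exp (((e * (j - (k + d)) : ℤ) : ℂ) * Complex.I * (θ : ℂ)) := by
    intro θ
    rw [Finset.sum_mul_sum, Finset.sum_comm, Finset.sum_mul]
    refine Finset.sum_congr rfl fun k _ => ?_
    rw [Finset.sum_mul]
    refine Finset.sum_congr rfl fun j _ => ?_
    simp only [← Complex.exp_nat_mul]
    rw [show ((e * (j - (k + d)) : ℤ) : ℂ) * Complex.I * (θ : ℂ) =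
      j * ((e * θ : ℂ) * Complex.I) + k * (-(e * θ : ℂ) * Complex.I)
        + d * (-(e * θ : ℂ) * Complex.I) by push_cast; ring, Complex.exp_add, Complex.exp_add]
    ring
  simp_rw [key]
  rw [intervalIntegral.integral_finsetSum
    (fun k _ => Continuous.intervalIntegrable (by fun_prop) _ _), Finset.mul_sum]
  refine Finset.sum_congr rfl fun k hk => ?_
  rw [intervalIntegral.integral_finsetSum
    (fun k _ => Continuous.intervalIntegrable (by fun_prop) _ _),
    Finset.sum_eq_single_of_mem (k + d) (by simpa using hk)]
  · rw [intervalIntegral.integral_const_mul, integral_exp_int_mul_I]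
    simp
    ring
  · intro j _ hj
    rw [intervalIntegral.integral_const_mul, integral_exp_int_mul_I, if_neg, mul_zero]
    refine mul_ne_zero he ?_
    omega

theorem one_add_pow_eq_sum_range (z : ℂ) {m n : ℕ} (h : m < n) :
    (1 + z) ^ m = ∑ k ∈ Finset.range n, (m.choose k : ℂ) * z ^ k := by
  rw [add_comm, add_pow]
  rw [Finset.sum_subset (Finset.range_mono h)]
  · simp [mul_comm]
  · intro k _ hk
    rw [Nat.choose_eq_zero_of_lt (by simpa using hk)]
    simp

theorem integral_pow_mul_exp_neg {N : ℝ} (hN : 0 < N) (p : ℕ) :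
    ∫ x in Set.Ioi (0:ℝ), x ^ p * Real.exp (-(N * x)) = p.factorial / N ^ (p + 1) := by
  have := Real.integral_rpow_mul_exp_neg_mul_Ioi (a := (p : ℝ) + 1) (by positivity) hN
  rw [Real.Gamma_nat_eq_factorial] at this
  simp only [add_sub_cancel_right, Real.rpow_natCast] at this
  rw [this, ← Nat.cast_succ, Real.rpow_natCast]
  simp [div_eq_mul_inv, mul_comm]

theorem integrableOn_pow_mul_exp_neg {N : ℝ} (hN : 0 < N) (p : ℕ) :
    IntegrableOn (fun x : ℝ => x ^ p * Real.exp (-(N * x))) (Set.Ioi 0) := by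
  refine Integrable.of_integral_ne_zero ?_
  rw [integral_pow_mul_exp_neg hN]
  positivity

theorem Ufun_zero (t : ℝ) (N : ℕ) (R₁ R₂ θ : ℝ) :
    Ufun t N 0 R₁ R₂ θ =
      ((t * Real.sqrt (R₁ * R₂) : ℝ) : ℂ) *
        (R₁ * Complex.exp (-(θ : ℂ) * Complex.I) + R₂ * Complex.exp ((θ : ℂ) * Complex.I)) +
      ((t ^ 2 / (N : ℝ) * (R₁ + R₂) : ℝ) : ℂ) := rfl

/-- The angular integral against `exp (∓ d i θ)` of a product of conjugate binomial powers. -/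
theorem integral_binomial_mul_binomial (c : ℂ) (m d : ℕ) {e : ℤ} (he : e ≠ 0) :
    ∫ θ in (0:ℝ)..(2 * Real.pi),
      (1 + c * Complex.exp ((e * θ : ℂ) * Complex.I)) ^ m *
      (1 + c * Complex.exp (-(e * θ : ℂ) * Complex.I)) ^ m *
      Complex.exp (-(e * θ : ℂ) * Complex.I) ^ d =
    2 * Real.pi * ∑ k ∈ Finset.range (m + 1),
      (m.choose (k + d) * m.choose k : ℂ) * c ^ (2 * k + d) := by
  have h := integral_trigPoly_mul_trigPoly (fun k => (m.choose k : ℂ) * c ^ k)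
    (fun k => (m.choose k : ℂ) * c ^ k) (m + 1) d he
  simp only [mul_assoc (Nat.cast _), ← mul_pow] at h
  have h1 : ∀ z : ℂ, _ := fun z => one_add_pow_eq_sum_range z (Nat.lt_succ_self m)
  have h2 : ∀ z : ℂ, _ := fun z =>
    one_add_pow_eq_sum_range z (show m < m + 1 + d by omega)
  simp only [Nat.succ_eq_add_one] at h1
  simp only [← h1, ← h2] at h
  rw [h]
  congr 1
  refine Finset.sum_congr rfl fun k _ => ?_
  ring

theorem Ffun_zero_eq (t : ℝ) (m : ℕ) {R₁ R₂ : ℝ} (h₁ : 0 < R₁) (h₂ : 0 < R₂) :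
    Ffun t (m + 2) 0 R₁ R₂ =
      ((∑ k ∈ Finset.range (m + 1), (m.choose k * (m + 1).choose (k + 1) : ℝ) *
        (t ^ (2 * k + 2) / ((m + 2 : ℕ) : ℝ) ^ (2 * k + 1)) *
        ((R₁ + R₂) * ((R₁ * R₂) ^ (k + 2))⁻¹) : ℝ) : ℂ) := by
  set N : ℕ := m + 2 with hN
  have hN0 : (N : ℂ) ≠ 0 := by simp [hN]; norm_cast
  have hR : 0 < R₁ * R₂ := mul_pos h₁ h₂
  set x : ℝ := Real.sqrt (R₁ * R₂) with hx
  have hx0 : 0 < x := Real.sqrt_pos.2 hR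
  have hxx : x ^ 2 = R₁ * R₂ := Real.sq_sqrt hR.le
  have hxC : (x : ℂ) ≠ 0 := by exact_mod_cast hx0.ne'
  set c : ℂ := t / (N * x) with hc
  have e1 := integral_binomial_mul_binomial c m 1 (one_ne_zero : (1 : ℤ) ≠ 0)
  have e2 := integral_binomial_mul_binomial c m 1 (by norm_num : (-1 : ℤ) ≠ 0)
  have e0 := integral_binomial_mul_binomial c m 0 (one_ne_zero : (1 : ℤ) ≠ 0)
  simp only [Int.cast_one, Int.cast_neg, one_mul, neg_mul, neg_neg, pow_one, pow_zero,
    mul_one, add_zero] at e0 e1 e2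
  have hint : ∀ θ : ℝ,
      (1 + (t : ℂ) * Complex.exp ((θ : ℂ) * Complex.I) / ((N : ℂ) * (x : ℝ))) ^ (N - 2) *
      (1 + (t : ℂ) * Complex.exp (-(θ : ℂ) * Complex.I) / ((N : ℂ) * (x : ℝ))) ^ (N - 2) *
      Ufun t N 0 R₁ R₂ θ =
      (t * x * R₁) * ((1 + c * Complex.exp (θ * Complex.I)) ^ m *
        (1 + c * Complex.exp (-(θ * Complex.I))) ^ m * Complex.exp (-(θ * Complex.I))) +
      (t * x * R₂) * ((1 + c * Complex.exp (-(θ * Complex.I))) ^ m *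
        (1 + c * Complex.exp (θ * Complex.I)) ^ m * Complex.exp (θ * Complex.I)) +
      (t ^ 2 / N * (R₁ + R₂)) * ((1 + c * Complex.exp (θ * Complex.I)) ^ m *
        (1 + c * Complex.exp (-(θ * Complex.I))) ^ m) := by
    intro θ
    rw [Ufun_zero, ← hx, show N - 2 = m by omega, mul_div_right_comm, mul_div_right_comm, ← hc]
    push_cast
    rw [neg_mul]
    ring
  unfold Ffun
  rw [← hx]
  simp_rw [hint]
  rw [intervalIntegral.integral_add (Continuous.intervalIntegrable (by fun_prop) _ _)
    (Continuous.intervalIntegrable (by fun_prop) _ _),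
    intervalIntegral.integral_add (Continuous.intervalIntegrable (by fun_prop) _ _)
    (Continuous.intervalIntegrable (by fun_prop) _ _)]
  simp only [intervalIntegral.integral_const_mul]
  rw [e0, e1, e2, ← hxx]
  push_cast
  have hpi : (Real.pi : ℂ) ≠ 0 := by exact_mod_cast Real.pi_ne_zero
  simp only [Finset.mul_sum, ← Finset.sum_add_distrib]
  refine Finset.sum_congr rfl fun k _ => ?_
  rw [Nat.choose_succ_succ', hc]
  push_cast
  simp only [div_pow, mul_pow]
  field_simp
  ring

theorem Ifun_zero_eq (t : ℝ) (m : ℕ) :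
    Ifun t (m + 2) 0 = ((((m + 2 : ℕ) : ℝ) / (2 * Real.pi) * Real.exp (2 * (m + 2 : ℕ)) *
      ∑ k ∈ Finset.range (m + 1), (m.choose k * (m + 1).choose (k + 1) : ℝ) *
        (t ^ (2 * k + 2) / ((m + 2 : ℕ) : ℝ) ^ (2 * k + 1)) *
        (2 * ((m - k).factorial / ((m + 2 : ℕ) : ℝ) ^ (m - k + 1)) *
          ((m - k + 1).factorial / ((m + 2 : ℕ) : ℝ) ^ (m - k + 2))) : ℝ) : ℂ) := by
  unfold Ifun
  rw [mul_assoc, Complex.ofReal_mul]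
  congr 1
  set N : ℕ := m + 2 with hN
  have hN0 : (0 : ℝ) < N := by rw [hN]; positivity
  let g : ℕ → ℝ → ℝ := fun p x => x ^ p * Real.exp (-(N * x))
  have hg : ∀ p, IntegrableOn (g p) (Set.Ioi 0) := integrableOn_pow_mul_exp_neg hN0
  have hgg : ∀ p q, IntegrableOn (fun R : ℝ × ℝ => g p R.1 * g q R.2)
      (Set.Ioi (0:ℝ) ×ˢ Set.Ioi (0:ℝ)) := fun p q => by
    rw [IntegrableOn, Measure.volume_eq_prod, ← Measure.prod_restrict]
    exact (hg p).mul_prod (hg q)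
  have hint : ∀ p q, ∫ R in (Set.Ioi (0:ℝ)) ×ˢ (Set.Ioi (0:ℝ)), g p R.1 * g q R.2 =
      (p.factorial / (N : ℝ) ^ (p + 1)) * (q.factorial / (N : ℝ) ^ (q + 1)) := fun p q => by
    rw [Measure.volume_eq_prod, setIntegral_prod_mul, integral_pow_mul_exp_neg hN0,
      integral_pow_mul_exp_neg hN0]
  have hcongr : ∀ R ∈ (Set.Ioi (0:ℝ)) ×ˢ (Set.Ioi (0:ℝ)),
      ((Real.exp (-(N : ℝ) * (R.1 - 1 - Real.log R.1)) *
          Real.exp (-(N : ℝ) * (R.2 - 1 - Real.log R.2)) : ℝ) : ℂ) * Ffun t N 0 R.1 R.2 =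
      ((∑ k ∈ Finset.range (m + 1), Real.exp (2 * N) *
        ((m.choose k * (m + 1).choose (k + 1) : ℝ) * (t ^ (2 * k + 2) / (N : ℝ) ^ (2 * k + 1))) *
        (g (m - k + 1) R.1 * g (m - k) R.2 + g (m - k) R.1 * g (m - k + 1) R.2) : ℝ) : ℂ) := by
    rintro ⟨R₁, R₂⟩ ⟨h₁ : 0 < R₁, h₂ : 0 < R₂⟩
    rw [Ffun_zero_eq t m h₁ h₂, ← Complex.ofReal_mul]
    congr 1
    have hexp : ∀ x : ℝ, 0 < x → Real.exp (-(N : ℝ) * (x - 1 - Real.log x)) =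
        Real.exp N * Real.exp (-(N * x)) * x ^ N := fun x hx => by
      rw [show -(N : ℝ) * (x - 1 - Real.log x) = N + -(N * x) + N * Real.log x by ring,
        Real.exp_add, Real.exp_add, Real.exp_nat_mul, Real.exp_log hx]
    simp only [hexp _ h₁, hexp _ h₂, Finset.mul_sum, g]
    refine Finset.sum_congr rfl fun k hk => ?_
    obtain ⟨l, rfl⟩ := Nat.exists_eq_add_of_le (Nat.lt_succ_iff.1 (Finset.mem_range.1 hk))
    rw [Nat.add_sub_cancel_left, two_mul (N : ℝ), Real.exp_add,
      show R₁ ^ N = R₁ ^ l * R₁ ^ (k + 2) by rw [hN, ← pow_add]; congr 1; omega,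
      show R₂ ^ N = R₂ ^ l * R₂ ^ (k + 2) by rw [hN, ← pow_add]; congr 1; omega, ← hN]
    field_simp
    ring
  rw [setIntegral_congr_fun (measurableSet_Ioi.prod measurableSet_Ioi) hcongr,
    integral_complex_ofReal]
  congr 1
  have hadd : ∀ p q, IntegrableOn (fun R : ℝ × ℝ => g p R.1 * g q R.2 + g q R.1 * g p R.2)
      (Set.Ioi (0:ℝ) ×ˢ Set.Ioi (0:ℝ)) := fun p q => (hgg p q).add (hgg q p)
  rw [integral_finsetSum _ fun k _ => (hadd _ _).const_mul _, Finset.mul_sum]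
  refine Finset.sum_congr rfl fun k _ => ?_
  rw [integral_const_mul, integral_add (hgg _ _) (hgg _ _), hint, hint]
  ring

theorem Ifun_zero_eq_stirlingSeq (t : ℝ) (m : ℕ) :
    Ifun t (m + 2) 0 = ((Stirling.stirlingSeq (m + 2) ^ 2 / Real.pi * (2 *
      ∑ k ∈ Finset.range (m + 1), ((m + 1 - k : ℝ) / (m + 1)) *
        (t ^ (2 * k + 2) / (k.factorial * (k + 1).factorial))) : ℝ) : ℂ) := by
  rw [Ifun_zero_eq]
  congr 1
  simp only [Finset.mul_sum]
  refine Finset.sum_congr rfl fun k hk => ?_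
  obtain ⟨l, rfl⟩ := Nat.exists_eq_add_of_le (Nat.lt_succ_iff.1 (Finset.mem_range.1 hk))
  have hf : ((k + l + 2).factorial : ℝ) = (k + l + 2) * (k + l + 1) * (k + l).factorial := by
    simp only [Nat.factorial_succ]; push_cast; ring
  have hf1 : ((k + l + 1).factorial : ℝ) = (k + l + 1) * (k + l).factorial := by
    simp only [Nat.factorial_succ]; push_cast; ring
  have hf2 : ((l + 1).factorial : ℝ) = (l + 1) * l.factorial := by
    simp only [Nat.factorial_succ]; push_cast; ring
  have hk := Real.sq_sqrt (show (0 : ℝ) ≤ 2 * (k + l + 2 : ℕ) by positivity)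
  rw [Stirling.stirlingSeq, Nat.add_sub_cancel_left, Nat.cast_add_choose,
    show k + l + 1 = k + 1 + l by omega, Nat.cast_add_choose, show k + 1 + l = k + l + 1 by omega,
    two_mul ((k + l + 2 : ℕ) : ℝ), Real.exp_add, div_pow, mul_pow, ← two_mul, hk, hf1, hf2, hf,
    div_pow, ← Real.exp_nat_mul, mul_one]
  have hN : ((k + l + 2 : ℕ) : ℝ) = k + l + 2 := by push_cast; ring
  rw [hN]
  have : (k + l + 2 : ℝ) ≠ 0 := by positivity
  push_cast
  field_simp
  ring

theorem summable_besselI_one (t : ℝ) :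
    Summable fun k : ℕ => t ^ (2 * k + 1) / (k.factorial * (k + 1).factorial : ℝ) := by
  refine Summable.of_norm_bounded ((Real.summable_pow_div_factorial (t ^ 2)).mul_left |t|) fun k => ?_
  have h : (1 : ℝ) ≤ (k + 1).factorial := by exact_mod_cast Nat.succ_le_of_lt (Nat.factorial_pos _)
  have h' : (0 : ℝ) < k.factorial := by exact_mod_cast Nat.factorial_pos _
  rw [Real.norm_eq_abs, abs_div, abs_pow, pow_succ, pow_mul, sq_abs, mul_comm, mul_div_assoc,
    abs_of_pos (show (0 : ℝ) < k.factorial * (k + 1).factorial by positivity)]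
  gcongr
  exact le_mul_of_one_le_right h'.le h

/-- The power series of `I₁`. -/
theorem hasSum_besselI_one (t : ℝ) :
    HasSum (fun k : ℕ => t ^ (2 * k + 1) / (k.factorial * (k + 1).factorial : ℝ))
      (besselI 1 (2 * t)) := by
  refine (summable_besselI_one t).hasSum_iff_tendsto_nat.2 ?_
  let S : ℕ → ℂ → ℂ := fun n z => ∑ j ∈ Finset.range n, (t * z) ^ j / (j.factorial : ℂ)
  have hScont : ∀ n, Continuous (S n) := fun n => by fun_prop
  have hSlim : ∀ z, Tendsto (fun n => S n z) atTop (nhds (Complex.exp (t * z))) := fun z => by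
    rw [Complex.exp_eq_exp_ℂ]
    exact (NormedSpace.expSeries_div_hasSum_exp (t * z : ℂ)).tendsto_sum_nat
  have hSbound : ∀ n z, ‖z‖ = 1 → ‖S n z‖ ≤ Real.exp |t| := fun n z hz => by
    refine (norm_sum_le _ _).trans (le_trans (le_of_eq ?_)
      (Real.sum_le_exp_of_nonneg (abs_nonneg t) n))
    refine Finset.sum_congr rfl fun j _ => ?_
    simp [hz]
  have hnorm : ∀ θ : ℝ, ‖Complex.exp (θ * Complex.I)‖ = 1 := Complex.norm_exp_ofReal_mul_I
  have hnorm' : ∀ θ : ℝ, ‖Complex.exp (-θ * Complex.I)‖ = 1 := fun θ => by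
    simpa using hnorm (-θ)
  have hint : Tendsto (fun n => ∫ θ in (0:ℝ)..(2 * Real.pi),
      S (n + 1) (Complex.exp (θ * Complex.I)) * S n (Complex.exp (-θ * Complex.I)) *
        Complex.exp (-θ * Complex.I)) atTop
      (nhds (∫ θ in (0:ℝ)..(2 * Real.pi),
        Complex.exp (t * Complex.exp (θ * Complex.I)) *
          Complex.exp (t * Complex.exp (-θ * Complex.I)) * Complex.exp (-θ * Complex.I))) := by
    refine intervalIntegral.tendsto_integral_filter_of_dominated_convergence
      (fun _ => Real.exp |t| * Real.exp |t| * 1) ?_ ?_ intervalIntegrable_const ?_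
    · exact Eventually.of_forall fun n => Continuous.aestronglyMeasurable (by fun_prop)
    · refine Eventually.of_forall fun n => Eventually.of_forall fun θ _ => ?_
      rw [norm_mul, norm_mul, hnorm']
      gcongr
      exacts [hSbound _ _ (hnorm θ), hSbound _ _ (hnorm' θ)]
    · exact Eventually.of_forall fun θ _ =>
        (((hSlim _).comp (tendsto_add_atTop_nat 1)).mul (hSlim _)).mul_const _
  have hre := ((Complex.continuous_re.tendsto _).comp hint).const_mul (1 / (2 * Real.pi))
  have hlim : (∫ θ in (0:ℝ)..(2 * Real.pi),
        Complex.exp (t * Complex.exp (θ * Complex.I)) *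
          Complex.exp (t * Complex.exp (-θ * Complex.I)) * Complex.exp (-θ * Complex.I)).re =
      ∫ θ in (0:ℝ)..(2 * Real.pi), Real.exp (2 * t * Real.cos θ) * Real.cos ((1 : ℕ) * θ) := by
    have := Complex.reCLM.intervalIntegral_comp_comm (μ := volume) (a := 0) (b := 2 * Real.pi)
      (f := fun θ : ℝ => Complex.exp (t * Complex.exp (θ * Complex.I)) *
          Complex.exp (t * Complex.exp (-θ * Complex.I)) * Complex.exp (-θ * Complex.I))
      (Continuous.intervalIntegrable (by fun_prop) _ _)
    simp only [Complex.reCLM_apply] at this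
    rw [← this]
    refine intervalIntegral.integral_congr fun θ _ => ?_
    have h : (t : ℂ) * Complex.exp (θ * Complex.I) + t * Complex.exp (-θ * Complex.I) =
        ((2 * t * Real.cos θ : ℝ) : ℂ) := by
      push_cast [Complex.cos]
      ring
    rw [← Complex.exp_add, h, ← Complex.ofReal_exp, Complex.re_ofReal_mul, ← Complex.ofReal_neg,
      Complex.exp_ofReal_mul_I_re, Real.cos_neg, Nat.cast_one, one_mul]
  rw [hlim] at hre
  refine hre.congr fun n => ?_
  have h := integral_trigPoly_mul_trigPoly (fun j => (t : ℂ) ^ j / (j.factorial : ℂ))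
    (fun j => (t : ℂ) ^ j / (j.factorial : ℂ)) n 1 (one_ne_zero : (1 : ℤ) ≠ 0)
  simp only [Int.cast_one, one_mul, pow_one, div_mul_eq_mul_div, ← mul_pow] at h
  simp only [Function.comp, S]
  rw [h, show (2 * Real.pi : ℂ) * ∑ k ∈ Finset.range n, (t : ℂ) ^ (k + 1) * (t ^ k / k.factorial) /
      (k + 1).factorial = ((2 * Real.pi * ∑ k ∈ Finset.range n,
        t ^ (2 * k + 1) / (k.factorial * (k + 1).factorial) : ℝ) : ℂ) by
    push_cast
    congr 1
    refine Finset.sum_congr rfl fun k _ => ?_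
    field_simp
    ring, Complex.ofReal_re]
  field_simp

theorem tendsto_weighted_sum {f : ℕ → ℝ} (hf : Summable f) (h0 : ∀ k, 0 ≤ f k) :
    Tendsto (fun m : ℕ => ∑ k ∈ Finset.range (m + 1), ((m + 1 - k : ℝ) / (m + 1)) * f k) atTop
      (nhds (∑' k, f k)) := by
  have key := tendsto_tsum_of_dominated_convergence (𝓕 := atTop) (bound := f) (g := f)
    (f := fun (m : ℕ) k => if k ∈ Finset.range (m + 1) then ((m + 1 - k : ℝ) / (m + 1)) * f k else 0)
    hf ?_ ?_
  · refine key.congr fun m => ?_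
    rw [tsum_eq_sum (s := Finset.range (m + 1)) fun k hk => if_neg hk]
    exact Finset.sum_congr rfl fun k hk => if_pos hk
  · intro k
    have h : Tendsto (fun m : ℕ => (1 - (k : ℝ) * (1 / ((m : ℝ) + 1))) * f k) atTop
        (nhds ((1 - k * 0) * f k)) :=
      ((tendsto_one_div_add_atTop_nhds_zero_nat.const_mul _).const_sub _).mul_const _
    rw [mul_zero, sub_zero, one_mul] at h
    refine h.congr' ?_
    filter_upwards [eventually_ge_atTop k] with m hm
    rw [if_pos (Finset.mem_range.2 (Nat.lt_succ_of_le hm))]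
    have : (m + 1 : ℝ) ≠ 0 := by positivity
    field_simp
  · refine Eventually.of_forall fun m k => ?_
    split_ifs with hk
    · have hk' : (k : ℝ) ≤ m + 1 := by exact_mod_cast (Finset.mem_range.1 hk).le
      rw [Real.norm_eq_abs, abs_of_nonneg
        (mul_nonneg (div_nonneg (by linarith) (by positivity)) (h0 k))]
      refine mul_le_of_le_one_left (h0 k) (div_le_one_of_le₀ ?_ (by positivity))
      linarith [(Nat.cast_nonneg k : (0 : ℝ) ≤ k)]
    · simpa using h0 k

/-- For fixed `t > 0`, `I_{0,N}(t) → 2t · I₁(2t)` as `N → ∞`. -/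
theorem I0N_tendsto (t : ℝ) (ht : 0 < t) :
    Tendsto (fun N : ℕ => Ifun t N 0) atTop
      (nhds (((2 * t * besselI 1 (2 * t) : ℝ)) : ℂ)) := by
  rw [← tendsto_add_atTop_iff_nat 2]
  simp_rw [Ifun_zero_eq_stirlingSeq]
  refine (Complex.continuous_ofReal.tendsto _).comp ?_
  have hsum : HasSum (fun k : ℕ => t ^ (2 * k + 2) / (k.factorial * (k + 1).factorial : ℝ))
      (t * besselI 1 (2 * t)) := by
    refine ((hasSum_besselI_one t).mul_left t).congr_fun fun k => ?_
    ring
  have hw := tendsto_weighted_sum hsum.summable fun k => by positivity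
  rw [hsum.tsum_eq] at hw
  have hs := ((Stirling.tendsto_stirlingSeq_sqrt_pi.comp (tendsto_add_atTop_nat 2)).pow 2).div_const
    Real.pi
  rw [Real.sq_sqrt Real.pi_pos.le, div_self Real.pi_ne_zero] at hs
  simpa [mul_assoc] using hs.mul (hw.const_mul 2)
end
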